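/- There exist an integer N ≥ N₀+1, a symmetric positive definite matrix P ∈ ℝ^{(2N+1)×(2N+1)}, and reals α > 1, β > 0, γ > 0 such that the block matrix Θ₁ = [[FᵀP + PF + 2δP + αγG, Pℒ],[ℒᵀP, −β]] is negative semidefinite and Θ₂ := 2γ(−(1−1/α)λ_{N+1} + q_c + δ) + βM₁ ≤ 0. (Feasibility of the LMI constraints of Theorem 2, Dirichlet boundary measurement case.) -/

import Mathlib

open Matrix

noncomputable section

/-- Negative semidefiniteness of a real matrix. -/
def Matrix.NegSemidef {ι : Type*} [Fintype ι] (M : Matrix ι ι ℝ) : Prop :=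
  (-M).PosSemidef

/-- All eigenvalues of the complexification of `M` have real part `< r`. -/
def specLt {ι : Type*} [Fintype ι] [DecidableEq ι] (M : Matrix ι ι ℝ) (r : ℝ) : Prop :=
  ∀ μ : ℂ, (M.map (Complex.ofReal ·)).charpoly.IsRoot μ → μ.re < r

/-- `A₀ = diag(-λ₁ + q_c, …, -λ_{N₀} + q_c)`. -/
def A0 (N₀ : ℕ) (lam : ℕ → ℝ) (qc : ℝ) : Matrix (Fin N₀) (Fin N₀) ℝ :=
  Matrix.diagonal fun i => -lam (i.1 + 1) + qc

/-- Column vector `(f 1, …, f N₀)ᵀ` (e.g. `B₀ₐ`, `B₀ᵦ`). -/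
def colVec (N₀ : ℕ) (f : ℕ → ℝ) : Matrix (Fin N₀) (Fin 1) ℝ :=
  Matrix.of fun i _ => f (i.1 + 1)

/-- `A₁ = [[0, 0], [B₀ₐ, A₀]]`. -/
def A1 (N₀ : ℕ) (lam : ℕ → ℝ) (qc : ℝ) (a : ℕ → ℝ) :
    Matrix (Fin 1 ⊕ Fin N₀) (Fin 1 ⊕ Fin N₀) ℝ :=
  Matrix.fromBlocks 0 0 (colVec N₀ a) (A0 N₀ lam qc)

/-- `B₁ = (1, b₁, …, b_{N₀})ᵀ`. -/
def B1 (N₀ : ℕ) (b : ℕ → ℝ) : Matrix (Fin 1 ⊕ Fin N₀) (Fin 1) ℝ :=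
  Matrix.of (Sum.elim (fun _ _ => 1) (fun i _ => b (i.1 + 1)))

/-- Row `C₀ = (f 1, …, f N₀)`. -/
def C0 (N₀ : ℕ) (f : ℕ → ℝ) : Matrix (Fin 1) (Fin N₀) ℝ :=
  Matrix.of fun _ j => f (j.1 + 1)

/-- `A₂ = diag(-λ_{N₀+1} + q_c, …, -λ_N + q_c)`. -/
def A2 (N₀ N : ℕ) (lam : ℕ → ℝ) (qc : ℝ) :
    Matrix (Fin (N - N₀)) (Fin (N - N₀)) ℝ :=
  Matrix.diagonal fun i => -lam (N₀ + 1 + i.1) + qc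

/-- Column vector `(f (N₀+1), …, f N)ᵀ` (e.g. `B₂ₐ`, `B₂ᵦ`). -/
def colVec2 (N₀ N : ℕ) (f : ℕ → ℝ) : Matrix (Fin (N - N₀)) (Fin 1) ℝ :=
  Matrix.of fun i _ => f (N₀ + 1 + i.1)

/-- Scaled row `C₁ = (x_{N₀+1}/√λ_{N₀+1}, …, x_N/√λ_N)` (Dirichlet measurement case). -/
def C1 (N₀ N : ℕ) (lam x : ℕ → ℝ) : Matrix (Fin 1) (Fin (N - N₀)) ℝ :=
  Matrix.of fun _ j => x (N₀ + 1 + j.1) / Real.sqrt (lam (N₀ + 1 + j.1))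

/-- `L̃ = (0, Lᵀ)ᵀ`. -/
def Ltil (N₀ : ℕ) (L : Matrix (Fin N₀) (Fin 1) ℝ) :
    Matrix (Fin 1 ⊕ Fin N₀) (Fin 1) ℝ :=
  Matrix.of (Sum.elim (fun _ _ => 0) (fun i j => L i j))

/-- `[B₂ₐ 0]`. -/
def B2a0 (N₀ N : ℕ) (a : ℕ → ℝ) : Matrix (Fin (N - N₀)) (Fin 1 ⊕ Fin N₀) ℝ :=
  Matrix.of fun i => Sum.elim (fun _ => a (N₀ + 1 + i.1)) (fun _ => 0)

/-- Closed-loop state index (total cardinality `2N+1` when `N₀ ≤ N`). -/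
abbrev ιF (N₀ N : ℕ) := ((Fin 1 ⊕ Fin N₀) ⊕ Fin N₀) ⊕ (Fin (N - N₀) ⊕ Fin (N - N₀))

/-- The closed-loop matrix `F` of (23), parametrized by the rows `C₀` and `C₁`. -/
def Fmat (N₀ N : ℕ) (lam a b : ℕ → ℝ) (qc : ℝ)
    (K : Matrix (Fin 1) (Fin 1 ⊕ Fin N₀) ℝ) (L : Matrix (Fin N₀) (Fin 1) ℝ)
    (C0m : Matrix (Fin 1) (Fin N₀) ℝ) (C1m : Matrix (Fin 1) (Fin (N - N₀)) ℝ) :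
    Matrix (ιF N₀ N) (ιF N₀ N) ℝ :=
  Matrix.fromBlocks
    (Matrix.fromBlocks (A1 N₀ lam qc a + B1 N₀ b * K) (Ltil N₀ L * C0m)
      0 (A0 N₀ lam qc - L * C0m))
    (Matrix.fromBlocks 0 (Ltil N₀ L * C1m) 0 (-(L * C1m)))
    (Matrix.fromBlocks (colVec2 N₀ N b * K + B2a0 N₀ N a) 0 0 0)
    (Matrix.fromBlocks (A2 N₀ N lam qc) 0 0 (A2 N₀ N lam qc))

/-- `ℒ = col(L̃, -L, 0, 0)`. -/
def Lcal (N₀ N : ℕ) (L : Matrix (Fin N₀) (Fin 1) ℝ) : Matrix (ιF N₀ N) (Fin 1) ℝ :=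
  Matrix.of
    (Sum.elim (Sum.elim (fun i j => Ltil N₀ L i j) (fun i j => -L i j)) fun _ _ => 0)

/-- `E = (1, 0, …, 0)`. -/
def Erow (N₀ N : ℕ) : Matrix (Fin 1) (ιF N₀ N) ℝ :=
  Matrix.of fun _ =>
    Sum.elim (Sum.elim (Sum.elim (fun _ => 1) fun _ => 0) fun _ => 0) fun _ => 0

/-- `K̃ = (K, 0, 0, 0)`. -/
def Ktil (N₀ N : ℕ) (K : Matrix (Fin 1) (Fin 1 ⊕ Fin N₀) ℝ) :
    Matrix (Fin 1) (ιF N₀ N) ℝ :=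
  Matrix.of fun r => Sum.elim (Sum.elim (fun j => K r j) fun _ => 0) fun _ => 0

/-- `G = ‖a‖² EᵀE + ‖b‖² K̃ᵀK̃`. -/
def Gmat (N₀ N : ℕ) (na2 nb2 : ℝ) (K : Matrix (Fin 1) (Fin 1 ⊕ Fin N₀) ℝ) :
    Matrix (ιF N₀ N) (ιF N₀ N) ℝ :=
  na2 • ((Erow N₀ N)ᵀ * Erow N₀ N) + nb2 • ((Ktil N₀ N K)ᵀ * Ktil N₀ N K)


lemma aux_isRoot_of_eig {ι : Type*} [Fintype ι] [DecidableEq ι] (M : Matrix ι ι ℂ) (μ : ℂ)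
    (v : ι → ℂ) (hv : v ≠ 0) (h : M *ᵥ v = μ • v) : M.charpoly.IsRoot μ := by
  rw [Polynomial.IsRoot, Matrix.eval_charpoly]
  apply Matrix.exists_mulVec_eq_zero_iff.mp
  refine ⟨v, hv, ?_⟩
  rw [Matrix.sub_mulVec, h]
  ext i
  simp [Matrix.scalar_apply, Matrix.mulVec_diagonal]

lemma aux_eig_of_spectrum {ι : Type*} [Fintype ι] [DecidableEq ι] (M : Matrix ι ι ℂ) (μ : ℂ)
    (h : μ ∈ spectrum ℂ M) : ∃ v : ι → ℂ, v ≠ 0 ∧ M *ᵥ v = μ • v := by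
  rw [Matrix.mem_spectrum_iff_isRoot_charpoly, Polynomial.IsRoot, Matrix.eval_charpoly] at h
  obtain ⟨v, hv, h⟩ := Matrix.exists_mulVec_eq_zero_iff.mpr h
  refine ⟨v, hv, ?_⟩
  rw [Matrix.sub_mulVec, sub_eq_zero] at h
  rw [← h]
  ext i
  simp [Matrix.scalar_apply, Matrix.mulVec_diagonal]

/-- the scalar computation behind the Cayley transform -/
lemma aux_cayley_scalar (μ : ℂ) (δ : ℝ) (h1 : μ ≠ 1)
    (h : (-(δ : ℂ) - (1 + μ) / (1 - μ)).re < -δ) : ‖μ‖ < 1 := by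
  have h2 : 0 < ((1 + μ) / (1 - μ)).re := by
    simp only [Complex.sub_re, Complex.neg_re, Complex.ofReal_re] at h
    linarith
  have h3 : 0 < Complex.normSq (1 - μ) :=
    Complex.normSq_pos.mpr (sub_ne_zero.mpr (Ne.symm h1))
  rw [Complex.div_re, ← add_div, div_pos_iff_of_pos_right h3] at h2
  simp at h2
  have h4 : ‖μ‖ ^ 2 < 1 := by
    rw [Complex.sq_norm, Complex.normSq_apply]
    nlinarith
  nlinarith [norm_nonneg μ]

open scoped Matrix.Norms.L2Operator in
lemma aux_pow_small {ι : Type*} [Fintype ι] [DecidableEq ι] [Nonempty ι] (M : Matrix ι ι ℂ)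
    (h : ∀ z ∈ spectrum ℂ M, ‖z‖ < 1) : ∃ n : ℕ, ‖M ^ n‖ < 1 := by
  have h1 : spectralRadius ℂ M < (1 : NNReal) :=
    spectrum.spectralRadius_lt_of_forall_lt M fun z hz => by
      have := h z hz
      exact_mod_cast this
  have h2 := spectrum.pow_nnnorm_pow_one_div_tendsto_nhds_spectralRadius M
  have h3 := (h2.eventually (gt_mem_nhds h1)).and (Filter.eventually_gt_atTop 0)
  obtain ⟨n, hn, hn0⟩ := h3.exists
  refine ⟨n, ?_⟩
  have hn' : ((‖M ^ n‖₊ : ENNReal)) < 1 := by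
    by_contra hc
    push Not at hc
    have := ENNReal.one_le_rpow hc (z := 1 / (n : ℝ)) (by positivity)
    exact absurd hn (not_lt.mpr (by simpa using this))
  exact_mod_cast hn'

open scoped Matrix.Norms.L2Operator in
lemma aux_real_contract {ι : Type*} [Fintype ι] [DecidableEq ι] (M : Matrix ι ι ℝ)
    (h : ‖M.map (Complex.ofReal ·)‖ < 1) (u : ι → ℝ) (hu : u ≠ 0) :
    (M *ᵥ u) ⬝ᵥ (M *ᵥ u) < u ⬝ᵥ u := by
  have key := Matrix.l2_opNorm_mulVec (M.map (Complex.ofReal ·))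
    (WithLp.toLp 2 (fun i => (u i : ℂ)))
  have h1 : ∀ w : ι → ℝ, ‖(WithLp.toLp 2 (fun i => (w i : ℂ)) : EuclideanSpace ℂ ι)‖ ^ 2
      = w ⬝ᵥ w := by
    intro w
    rw [EuclideanSpace.norm_sq_eq]
    simp [dotProduct, sq]
  have h2 : (M.map (Complex.ofReal ·)) *ᵥ (fun i => (u i : ℂ))
      = fun i => ((M *ᵥ u) i : ℂ) := by
    ext i
    simp [Matrix.mulVec, dotProduct]
  have h3 : ‖(WithLp.toLp 2 (fun i => ((M *ᵥ u) i : ℂ)) : EuclideanSpace ℂ ι)‖ ≤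
      ‖M.map (Complex.ofReal ·)‖ * ‖(WithLp.toLp 2 (fun i => (u i : ℂ)) : EuclideanSpace ℂ ι)‖ := by
    rw [← h2]; exact key
  have hpos : 0 < u ⬝ᵥ u := by
    have := Matrix.dotProduct_star_self_pos_iff.mpr hu
    simpa using this
  rw [← h1 u] at hpos ⊢
  rw [← h1 (M *ᵥ u)]
  have hp : 0 < ‖(WithLp.toLp 2 (fun i => (u i : ℂ)) : EuclideanSpace ℂ ι)‖ := by
    by_contra hc
    have := le_antisymm (not_lt.mp hc) (norm_nonneg _)
    rw [this] at hpos
    simp at hpos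
  have h4 : ‖(WithLp.toLp 2 (fun i => ((M *ᵥ u) i : ℂ)) : EuclideanSpace ℂ ι)‖ <
    ‖(WithLp.toLp 2 (fun i => (u i : ℂ)) : EuclideanSpace ℂ ι)‖ := by nlinarith
  exact pow_lt_pow_left₀ h4 (norm_nonneg _) two_ne_zero

lemma aux_coercive {ι : Type*} [Fintype ι] (M : Matrix ι ι ℝ)
    (h : ∀ u : ι → ℝ, u ≠ 0 → 0 < u ⬝ᵥ (M *ᵥ u)) :
    ∃ ε : ℝ, 0 < ε ∧ ∀ u : ι → ℝ, ε * (u ⬝ᵥ u) ≤ u ⬝ᵥ (M *ᵥ u) := by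
  rcases isEmpty_or_nonempty ι with hE | hE
  · exact ⟨1, one_pos, fun u => by simp⟩
  have hc : IsCompact (Metric.sphere (0 : ι → ℝ) 1) := isCompact_sphere _ _
  have hne : (Metric.sphere (0 : ι → ℝ) 1).Nonempty := NormedSpace.sphere_nonempty.mpr zero_le_one
  obtain ⟨v, hv, hmin⟩ := hc.exists_isMinOn hne
    (f := fun u : ι → ℝ => u ⬝ᵥ (M *ᵥ u)) (by
      apply Continuous.continuousOn
      simp only [dotProduct, Matrix.mulVec]
      fun_prop)
  have hv0 : v ≠ 0 := by
    rintro rfl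
    simp at hv
  have hm := h v hv0
  set m := v ⬝ᵥ (M *ᵥ v) with hmdef
  have hcard : (0 : ℝ) < Fintype.card ι := by exact_mod_cast Fintype.card_pos
  refine ⟨m / Fintype.card ι, by positivity, fun u => ?_⟩
  by_cases hu : u = 0
  · simp [hu]
  have hnu : 0 < ‖u‖ := norm_pos_iff.mpr hu
  have h1 : m ≤ (‖u‖⁻¹ • u) ⬝ᵥ (M *ᵥ (‖u‖⁻¹ • u)) := by
    apply hmin
    simp [norm_smul, hnu.ne']
  rw [Matrix.mulVec_smul, smul_dotProduct, dotProduct_smul] at h1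
  simp only [smul_eq_mul] at h1
  have h2 : m * ‖u‖ ^ 2 ≤ u ⬝ᵥ (M *ᵥ u) := by
    have : ‖u‖⁻¹ * (‖u‖⁻¹ * u ⬝ᵥ (M *ᵥ u)) = (u ⬝ᵥ (M *ᵥ u)) / ‖u‖ ^ 2 := by
      field_simp
    rw [this, le_div_iff₀ (by positivity)] at h1
    exact h1
  have h3 : u ⬝ᵥ u ≤ Fintype.card ι * ‖u‖ ^ 2 := by
    rw [dotProduct]
    calc ∑ i, u i * u i ≤ ∑ i : ι, ‖u‖ ^ 2 := by
          apply Finset.sum_le_sum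
          intro i _
          have := norm_le_pi_norm u i
          rw [Real.norm_eq_abs] at this
          rw [← sq, ← sq_abs]
          exact pow_le_pow_left₀ (abs_nonneg _) this 2
      _ = _ := by simp
  calc m / Fintype.card ι * (u ⬝ᵥ u) ≤ m / Fintype.card ι * (Fintype.card ι * ‖u‖ ^ 2) := by
        gcongr
    _ = m * ‖u‖ ^ 2 := by field_simp
    _ ≤ _ := h2

lemma aux_lyapunov {ι : Type*} [Fintype ι] [DecidableEq ι] [Nonempty ι] (S : Matrix ι ι ℝ)
    (δ : ℝ) (hS : specLt S (-δ)) :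
    ∃ P : Matrix ι ι ℝ, P.IsSymm ∧ (∀ u, u ≠ 0 → 0 < u ⬝ᵥ (P *ᵥ u)) ∧
      ∀ u, 2 * ((S *ᵥ u) ⬝ᵥ (P *ᵥ u)) + 2 * δ * (u ⬝ᵥ (P *ᵥ u)) ≤ - (u ⬝ᵥ u) := by
  have heig : ∀ (μ : ℂ) (v : ι → ℂ), v ≠ 0 → (S.map (Complex.ofReal ·)) *ᵥ v = μ • v →
      μ.re < -δ := fun μ v hv h => hS μ (aux_isRoot_of_eig _ _ _ hv h)
  set D : Matrix ι ι ℝ := S + (δ - 1) • 1 with hD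
  set E : Matrix ι ι ℝ := S + (δ + 1) • 1 with hE
  have hDdet : D.det ≠ 0 := by
    intro h0
    obtain ⟨v, hv, h⟩ := Matrix.exists_mulVec_eq_zero_iff.mpr h0
    have := heig ((1 - δ : ℝ) : ℂ) (fun i => (v i : ℂ)) (by
      intro hc
      apply hv
      ext i
      have := congrFun hc i
      simpa using this) (by
      ext i
      have h1 := congrFun h i
      simp only [hD, Matrix.add_mulVec, Matrix.smul_mulVec, Matrix.one_mulVec, Pi.add_apply,
        Pi.smul_apply, Pi.zero_apply, smul_eq_mul] at h1
      have h2 : (S *ᵥ v) i = (1 - δ) * v i := by linarith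
      have h3 : ((S.map (Complex.ofReal ·)) *ᵥ (fun i => (v i : ℂ))) i = (((S *ᵥ v) i : ℝ) : ℂ) := by
        simp [Matrix.mulVec, dotProduct]
      rw [h3, h2]
      simp)
    rw [Complex.ofReal_re] at this
    linarith
  have hDu : IsUnit D.det := isUnit_iff_ne_zero.mpr hDdet
  set C : Matrix ι ι ℝ := E * D⁻¹ with hC
  have hCD : C * D = E := by rw [hC, Matrix.mul_assoc, Matrix.nonsing_inv_mul _ hDu, Matrix.mul_one]
  let f : Matrix ι ι ℝ →+* Matrix ι ι ℂ := (Complex.ofRealHom).mapMatrix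
  have hf : ∀ M : Matrix ι ι ℝ, M.map (Complex.ofReal ·) = f M := fun M => rfl
  have hfs : ∀ r : ℝ, f (r • 1) = (r : ℂ) • 1 := by
    intro r
    rw [← hf]
    ext i j
    by_cases hij : i = j
    · simp [hij]
    · simp [hij]
  have hspec : ∀ z ∈ spectrum ℂ (f C), ‖z‖ < 1 := by
    intro μ hμ
    obtain ⟨v, hv, h⟩ := aux_eig_of_spectrum _ _ hμ
    set w := f D⁻¹ *ᵥ v with hw
    have hvw : v = f D *ᵥ w := by
      rw [hw, Matrix.mulVec_mulVec, ← map_mul, Matrix.mul_nonsing_inv _ hDu, map_one,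
        Matrix.one_mulVec]
    have hw0 : w ≠ 0 := by
      intro h0
      apply hv
      rw [hvw, h0, Matrix.mulVec_zero]
    rw [hvw, Matrix.mulVec_mulVec, ← map_mul, hCD] at h
    simp only [hE, hD, map_add, hfs, Matrix.add_mulVec, Matrix.smul_mulVec, Matrix.one_mulVec] at h
    have hμ1 : μ ≠ 1 := by
      rintro rfl
      apply hw0
      ext i
      have := congrFun h i
      simp only [Pi.add_apply, Pi.smul_apply, smul_eq_mul, Complex.ofReal_add,
        Complex.ofReal_sub, Complex.ofReal_one] at this
      have h2 : (2 : ℂ) * w i = 0 := by linear_combination this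
      simpa using h2
    refine aux_cayley_scalar μ δ hμ1 (heig _ w hw0 ?_)
    have h1μ : 1 - μ ≠ 0 := sub_ne_zero.mpr (Ne.symm hμ1)
    ext i
    have := congrFun h i
    simp at this
    rw [hf]
    simp only [Pi.smul_apply, smul_eq_mul]
    field_simp
    linear_combination this
  obtain ⟨n, hn⟩ := aux_pow_small _ hspec
  rw [← map_pow, ← hf] at hn
  have hcon := aux_real_contract _ hn
  -- the finite Stein sum
  have hn1 : 1 ≤ n := by
    rcases Nat.eq_zero_or_pos n with h0 | h0
    · exfalso
      obtain ⟨i⟩ := ‹Nonempty ι›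
      have := hcon (fun _ => 1) (by intro hc; simpa using congrFun hc i)
      simp [h0] at this
    · exact h0
  set P : Matrix ι ι ℝ := ∑ k ∈ Finset.range n, (C ^ k)ᵀ * C ^ k with hP
  have hPsymm : P.IsSymm := by
    rw [Matrix.IsSymm, hP, Matrix.transpose_sum]
    simp [Matrix.transpose_mul]
  have hPq : ∀ u, u ⬝ᵥ (P *ᵥ u) = ∑ k ∈ Finset.range n, (C ^ k *ᵥ u) ⬝ᵥ (C ^ k *ᵥ u) := by
    intro u
    rw [hP, Matrix.sum_mulVec, dotProduct_sum]
    refine Finset.sum_congr rfl fun k _ => ?_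
    rw [← Matrix.mulVec_mulVec, Matrix.dotProduct_mulVec, Matrix.vecMul_transpose]
  have hnn : ∀ w : ι → ℝ, 0 ≤ w ⬝ᵥ w := fun w => Finset.sum_nonneg fun i _ => mul_self_nonneg _
  have hpp : ∀ w : ι → ℝ, w ≠ 0 → 0 < w ⬝ᵥ w := by
    intro w hw
    have := Matrix.dotProduct_star_self_pos_iff.mpr hw
    simpa using this
  have hPpos : ∀ u, u ≠ 0 → 0 < u ⬝ᵥ (P *ᵥ u) := by
    intro u hu
    rw [hPq]
    have h0 : (C ^ 0 *ᵥ u) ⬝ᵥ (C ^ 0 *ᵥ u) ≤ ∑ k ∈ Finset.range n, (C ^ k *ᵥ u) ⬝ᵥ (C ^ k *ᵥ u) :=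
      Finset.single_le_sum (f := fun k => (C ^ k *ᵥ u) ⬝ᵥ (C ^ k *ᵥ u)) (fun k _ => hnn _)
        (Finset.mem_range.mpr hn1)
    refine lt_of_lt_of_le ?_ h0
    simpa using hpp u hu
  have hstein : ∀ v, v ≠ 0 → (C *ᵥ v) ⬝ᵥ (P *ᵥ (C *ᵥ v)) < v ⬝ᵥ (P *ᵥ v) := by
    intro v hv
    rw [hPq, hPq]
    have h1 : ∀ k, C ^ k *ᵥ (C *ᵥ v) = C ^ (k + 1) *ᵥ v := by
      intro k
      rw [Matrix.mulVec_mulVec, pow_succ]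
    simp only [h1]
    have h2 := Finset.sum_range_sub (fun k => (C ^ k *ᵥ v) ⬝ᵥ (C ^ k *ᵥ v)) n
    rw [Finset.sum_sub_distrib] at h2
    have h3 := hcon v hv
    simp only [pow_zero, Matrix.one_mulVec] at h2
    linarith
  have hsw : ∀ u w, u ⬝ᵥ (P *ᵥ w) = w ⬝ᵥ (P *ᵥ u) := by
    intro u w
    rw [Matrix.dotProduct_mulVec, ← Matrix.mulVec_transpose, hPsymm.eq, dotProduct_comm]
  have hlyap : ∀ u, u ≠ 0 → 2 * ((S *ᵥ u) ⬝ᵥ (P *ᵥ u)) + 2 * δ * (u ⬝ᵥ (P *ᵥ u)) < 0 := by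
    intro u hu
    have hDu0 : D *ᵥ u ≠ 0 := by
      intro hc
      exact hDdet (Matrix.exists_mulVec_eq_zero_iff.mp ⟨u, hu, hc⟩)
    have h1 := hstein _ hDu0
    rw [Matrix.mulVec_mulVec, hCD] at h1
    simp only [hE, hD, Matrix.add_mulVec, Matrix.smul_mulVec, Matrix.one_mulVec,
      Matrix.mulVec_add, Matrix.mulVec_smul, dotProduct_add, add_dotProduct, smul_dotProduct,
      dotProduct_smul, smul_eq_mul] at h1
    rw [hsw u (S *ᵥ u)] at h1
    nlinarith
  obtain ⟨ε, hε, hco⟩ := aux_coercive (-(2 : ℝ) • (P * S) - (2 * δ) • P) (by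
    intro u hu
    have := hlyap u hu
    simp only [Matrix.sub_mulVec, Matrix.smul_mulVec, ← Matrix.mulVec_mulVec, dotProduct_sub,
      dotProduct_smul, smul_eq_mul]
    rw [hsw u (S *ᵥ u)]
    linarith)
  refine ⟨ε⁻¹ • P, ?_, ?_, ?_⟩
  · rw [Matrix.IsSymm, Matrix.transpose_smul, hPsymm.eq]
  · intro u hu
    rw [Matrix.smul_mulVec, dotProduct_smul]
    exact mul_pos (inv_pos.mpr hε) (hPpos u hu)
  · intro u
    have := hco u
    simp only [Matrix.sub_mulVec, Matrix.smul_mulVec, ← Matrix.mulVec_mulVec, dotProduct_sub,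
      dotProduct_smul, smul_eq_mul] at this
    rw [hsw u (S *ᵥ u)] at this
    simp only [Matrix.smul_mulVec, dotProduct_smul, smul_eq_mul]
    have h2 : 2 * (ε⁻¹ * ((S *ᵥ u) ⬝ᵥ (P *ᵥ u))) + 2 * δ * (ε⁻¹ * (u ⬝ᵥ (P *ᵥ u)))
      = - (ε⁻¹ * (-2 * ((S *ᵥ u) ⬝ᵥ (P *ᵥ u)) - 2 * δ * (u ⬝ᵥ (P *ᵥ u)))) := by ring
    rw [h2, neg_le_neg_iff, ← div_eq_inv_mul, le_div_iff₀ hε]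
    linarith

lemma aux_negsemidef {ι : Type*} [Fintype ι] [DecidableEq ι] (F P G : Matrix ι ι ℝ)
    (Lc : Matrix ι (Fin 1) ℝ) (δ c β : ℝ) (hP : P.IsSymm) (hG : G.IsSymm)
    (h : ∀ (y : ι → ℝ) (z : ℝ), 2 * ((F *ᵥ y) ⬝ᵥ (P *ᵥ y)) + 2 * δ * (y ⬝ᵥ (P *ᵥ y))
      + c * (y ⬝ᵥ (G *ᵥ y)) + 2 * z * ((fun i => Lc i 0) ⬝ᵥ (P *ᵥ y)) - β * z ^ 2 ≤ 0) :
    (Matrix.fromBlocks (Fᵀ * P + P * F + (2 * δ) • P + c • G) (P * Lc) (Lcᵀ * P)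
      ((-β) • (1 : Matrix (Fin 1) (Fin 1) ℝ))).NegSemidef := by
  unfold Matrix.NegSemidef
  refine Matrix.PosSemidef.of_dotProduct_mulVec_nonneg ?_ ?_
  · apply Matrix.IsHermitian.neg
    rw [Matrix.IsHermitian, Matrix.conjTranspose_eq_transpose_of_trivial,
      Matrix.fromBlocks_transpose]
    simp only [Matrix.transpose_add, Matrix.transpose_mul, Matrix.transpose_smul,
      Matrix.transpose_transpose, Matrix.transpose_one, hP.eq, hG.eq]
    rw [add_comm (P * F)]
  · intro Y
    obtain ⟨y, z, rfl⟩ : ∃ (y : ι → ℝ) (z : Fin 1 → ℝ), Y = Sum.elim y z :=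
      ⟨Y ∘ Sum.inl, Y ∘ Sum.inr, (Sum.elim_comp_inl_inr Y).symm⟩
    have hsw : ∀ u w, u ⬝ᵥ (P *ᵥ w) = w ⬝ᵥ (P *ᵥ u) := by
      intro u w
      rw [Matrix.dotProduct_mulVec, ← Matrix.mulVec_transpose, hP.eq, dotProduct_comm]
    have hLz : Lc *ᵥ z = z 0 • (fun i => Lc i 0) := by
      ext i
      simp [Matrix.mulVec, dotProduct, mul_comm]
    have h1 := h y (z 0)
    rw [star_trivial, Matrix.neg_mulVec, dotProduct_neg, Matrix.fromBlocks_mulVec]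
    simp only [Sum.elim_comp_inl, Sum.elim_comp_inr, sumElim_dotProduct_sumElim]
    simp only [Matrix.add_mulVec, Matrix.smul_mulVec, ← Matrix.mulVec_mulVec, dotProduct_add,
      dotProduct_smul, smul_eq_mul, Matrix.one_mulVec, hLz, Matrix.mulVec_smul]
    rw [hsw y (F *ᵥ y), hsw y (fun i => Lc i 0), Matrix.dotProduct_mulVec y Fᵀ,
      Matrix.vecMul_transpose, Matrix.dotProduct_mulVec z Lcᵀ, Matrix.vecMul_transpose, hLz,
      smul_dotProduct]
    have hz : z ⬝ᵥ z = z 0 ^ 2 := by simp [dotProduct, sq]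
    rw [hz]
    simp only [smul_eq_mul]
    linarith

lemma aux_cs {ι : Type*} [Fintype ι] (u v : ι → ℝ) : (u ⬝ᵥ v) ^ 2 ≤ (u ⬝ᵥ u) * (v ⬝ᵥ v) := by
  have := Finset.sum_mul_sq_le_sq_mul_sq Finset.univ u v
  simpa [dotProduct, sq] using this

lemma aux_sum_le (f : ℕ → ℝ) (hf : Summable f) (h0 : ∀ n, 0 ≤ f n) (m k : ℕ) :
    ∑ i : Fin m, f (k + i.1) ≤ ∑' n, f n := by
  rw [Fin.sum_univ_eq_sum_range (fun i => f (k + i)) m]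
  have h1 := (summable_nat_add_iff k).mpr hf
  have h2 := hf.sum_add_tsum_nat_add k
  have h3 : ∑ i ∈ Finset.range m, f (i + k) ≤ ∑' n, f (n + k) :=
    h1.sum_le_tsum _ fun i _ => h0 _
  have h4 : 0 ≤ ∑ i ∈ Finset.range k, f i := Finset.sum_nonneg fun i _ => h0 i
  simp only [add_comm k]
  linarith

lemma aux_dot_self_nonneg {ι : Type*} [Fintype ι] (u : ι → ℝ) : 0 ≤ u ⬝ᵥ u :=
  Finset.sum_nonneg fun i _ => mul_self_nonneg _

lemma aux_young (s A B c : ℝ) (hc : 0 < c) (hB : 0 ≤ B) (hA : 0 ≤ A) (h : s ^ 2 ≤ A * B) :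
    2 * s ≤ c * A + c⁻¹ * B := by
  have h1 : 0 ≤ c * A + c⁻¹ * B := by positivity
  apply le_of_sq_le_sq _ h1
  have h2 : (c * A + c⁻¹ * B) ^ 2 - 4 * (A * B) = (c * A - c⁻¹ * B) ^ 2 := by
    field_simp
    ring
  nlinarith [sq_nonneg (c * A - c⁻¹ * B)]

lemma aux_specLt_blocks {ι κ : Type*} [Fintype ι] [DecidableEq ι] [Fintype κ] [DecidableEq κ]
    (A : Matrix ι ι ℝ) (B : Matrix ι κ ℝ) (D : Matrix κ κ ℝ) (r : ℝ) (hA : specLt A r)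
    (hD : specLt D r) : specLt (Matrix.fromBlocks A B 0 D) r := by
  intro μ hμ
  rw [Matrix.fromBlocks_map, Matrix.map_zero _ (by simp), Matrix.charpoly_fromBlocks_zero₂₁,
    Polynomial.IsRoot, Polynomial.eval_mul, mul_eq_zero] at hμ
  rcases hμ with h | h
  · exact hA μ h
  · exact hD μ h

/-- action of the closed-loop matrix on a block vector -/
lemma aux_Fmat_mulVec (N₀ N : ℕ) (lam a b : ℕ → ℝ) (qc : ℝ)
    (K : Matrix (Fin 1) (Fin 1 ⊕ Fin N₀) ℝ) (L : Matrix (Fin N₀) (Fin 1) ℝ)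
    (C0m : Matrix (Fin 1) (Fin N₀) ℝ) (C1m : Matrix (Fin 1) (Fin (N - N₀)) ℝ)
    (u1 : Fin 1 ⊕ Fin N₀ → ℝ) (u2 : Fin N₀ → ℝ) (w1 w2 : Fin (N - N₀) → ℝ) :
    Fmat N₀ N lam a b qc K L C0m C1m *ᵥ (Sum.elim (Sum.elim u1 u2) (Sum.elim w1 w2)) =
    Sum.elim
      ((Matrix.fromBlocks (A1 N₀ lam qc a + B1 N₀ b * K) (Ltil N₀ L * C0m)
        0 (A0 N₀ lam qc - L * C0m)) *ᵥ (Sum.elim u1 u2)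
        + (C1m *ᵥ w2) 0 • Sum.elim (fun i => Ltil N₀ L i 0) (fun i => - L i 0))
      (Sum.elim ((fun i => b (N₀ + 1 + i.1) * (K *ᵥ u1) 0 + a (N₀ + 1 + i.1) * u1 (Sum.inl 0))
          + A2 N₀ N lam qc *ᵥ w1) (A2 N₀ N lam qc *ᵥ w2)) := by
  have h1 : ∀ (ι : Type) (M : Matrix ι (Fin 1) ℝ) (z : Fin 1 → ℝ) (i : ι),
      (M *ᵥ z) i = z 0 * M i 0 := by
    intro ι M z i
    simp [Matrix.mulVec, dotProduct, mul_comm]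
  rw [Fmat, Matrix.fromBlocks_mulVec]
  simp only [Sum.elim_comp_inl, Sum.elim_comp_inr]
  congr 1
  · congr 1
    rw [Matrix.fromBlocks_mulVec]
    simp only [Sum.elim_comp_inl, Sum.elim_comp_inr, Matrix.zero_mulVec, zero_add]
    ext i
    rcases i with i | i
    · simp [← Matrix.mulVec_mulVec, h1]
    · simp [← Matrix.mulVec_mulVec, h1, Matrix.neg_mulVec]
  · rw [Matrix.fromBlocks_mulVec, Matrix.fromBlocks_mulVec]
    simp only [Sum.elim_comp_inl, Sum.elim_comp_inr, Matrix.zero_mulVec, add_zero, zero_add]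
    ext i
    rcases i with i | i
    · simp only [Pi.add_apply, Sum.elim_inl, Matrix.add_mulVec, ← Matrix.mulVec_mulVec, h1]
      simp [colVec2, B2a0, Matrix.mulVec, dotProduct]
      ring
    · simp

lemma aux_A2_le (N₀ N : ℕ) (lam : ℕ → ℝ) (qc κ δ : ℝ)
    (h : ∀ n, N₀ + 1 ≤ n → -lam n + qc ≤ -δ - κ) (w : Fin (N - N₀) → ℝ) :
    (A2 N₀ N lam qc *ᵥ w) ⬝ᵥ w ≤ -(δ + κ) * (w ⬝ᵥ w) := by
  simp only [A2, dotProduct, Matrix.mulVec_diagonal, Finset.mul_sum]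
  refine Finset.sum_le_sum fun i _ => ?_
  have := h (N₀ + 1 + i.1) (by omega)
  nlinarith [mul_self_nonneg (w i)]

lemma aux_G_quad (N₀ N : ℕ) (na2 nb2 : ℝ) (K : Matrix (Fin 1) (Fin 1 ⊕ Fin N₀) ℝ)
    (u1 : Fin 1 ⊕ Fin N₀ → ℝ) (u2 : Fin N₀ → ℝ) (w : Fin (N - N₀) ⊕ Fin (N - N₀) → ℝ) :
    (Sum.elim (Sum.elim u1 u2) w) ⬝ᵥ (Gmat N₀ N na2 nb2 K *ᵥ (Sum.elim (Sum.elim u1 u2) w))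
      = na2 * u1 (Sum.inl 0) ^ 2 + nb2 * ((K *ᵥ u1) 0) ^ 2 := by
  have h1 : Erow N₀ N *ᵥ (Sum.elim (Sum.elim u1 u2) w) = fun _ => u1 (Sum.inl 0) := by
    ext i
    simp [Erow, Matrix.mulVec, dotProduct]
  have h2 : Ktil N₀ N K *ᵥ (Sum.elim (Sum.elim u1 u2) w) = fun _ => (K *ᵥ u1) 0 := by
    ext i
    have : i = 0 := Subsingleton.elim _ _
    subst this
    simp [Ktil, Matrix.mulVec, dotProduct]
  simp only [Gmat, Matrix.add_mulVec, Matrix.smul_mulVec, ← Matrix.mulVec_mulVec, dotProduct_add,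
    dotProduct_smul, smul_eq_mul]
  rw [Matrix.dotProduct_mulVec _ (Erow N₀ N)ᵀ, Matrix.dotProduct_mulVec _ (Ktil N₀ N K)ᵀ,
    Matrix.vecMul_transpose, Matrix.vecMul_transpose, h1, h2]
  simp [dotProduct, sq]

lemma aux_G_symm (N₀ N : ℕ) (na2 nb2 : ℝ) (K : Matrix (Fin 1) (Fin 1 ⊕ Fin N₀) ℝ) :
    (Gmat N₀ N na2 nb2 K).IsSymm := by
  simp [Matrix.IsSymm, Gmat, Matrix.transpose_mul]

/-- the block-diagonal Lyapunov matrix -/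
def auxP (N₀ N : ℕ) (P1 : Matrix ((Fin 1 ⊕ Fin N₀) ⊕ Fin N₀) ((Fin 1 ⊕ Fin N₀) ⊕ Fin N₀) ℝ)
    (m1 m2 : ℝ) : Matrix (ιF N₀ N) (ιF N₀ N) ℝ :=
  Matrix.fromBlocks P1 0 0 (Matrix.fromBlocks (m1 • 1) 0 0 (m2 • 1))

lemma auxP_symm (N₀ N : ℕ)
    (P1 : Matrix ((Fin 1 ⊕ Fin N₀) ⊕ Fin N₀) ((Fin 1 ⊕ Fin N₀) ⊕ Fin N₀) ℝ)
    (m1 m2 : ℝ) (h : P1.IsSymm) : (auxP N₀ N P1 m1 m2).IsSymm := by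
  simp [Matrix.IsSymm, auxP, Matrix.fromBlocks_transpose, h.eq]

lemma auxP_mulVec (N₀ N : ℕ)
    (P1 : Matrix ((Fin 1 ⊕ Fin N₀) ⊕ Fin N₀) ((Fin 1 ⊕ Fin N₀) ⊕ Fin N₀) ℝ)
    (m1 m2 : ℝ) (u : (Fin 1 ⊕ Fin N₀) ⊕ Fin N₀ → ℝ) (w1 w2 : Fin (N - N₀) → ℝ) :
    auxP N₀ N P1 m1 m2 *ᵥ (Sum.elim u (Sum.elim w1 w2)) =
      Sum.elim (P1 *ᵥ u) (Sum.elim (m1 • w1) (m2 • w2)) := by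
  simp [auxP, Matrix.fromBlocks_mulVec, Matrix.smul_mulVec]

lemma auxP_posDef (N₀ N : ℕ)
    (P1 : Matrix ((Fin 1 ⊕ Fin N₀) ⊕ Fin N₀) ((Fin 1 ⊕ Fin N₀) ⊕ Fin N₀) ℝ)
    (m1 m2 : ℝ) (h : P1.IsSymm) (hp : ∀ u, u ≠ 0 → 0 < u ⬝ᵥ (P1 *ᵥ u)) (h1 : 0 < m1)
    (h2 : 0 < m2) : (auxP N₀ N P1 m1 m2).PosDef := by
  refine Matrix.PosDef.of_dotProduct_mulVec_pos ?_ ?_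
  · rw [Matrix.IsHermitian, Matrix.conjTranspose_eq_transpose_of_trivial]
    exact auxP_symm N₀ N P1 m1 m2 h
  · intro y hy
    obtain ⟨u, w1, w2, rfl⟩ : ∃ u w1 w2, y = Sum.elim u (Sum.elim w1 w2) :=
      ⟨y ∘ Sum.inl, (y ∘ Sum.inr) ∘ Sum.inl, (y ∘ Sum.inr) ∘ Sum.inr, by
        rw [Sum.elim_comp_inl_inr, Sum.elim_comp_inl_inr]⟩
    rw [star_trivial, auxP_mulVec]
    simp only [sumElim_dotProduct_sumElim, dotProduct_smul, smul_eq_mul]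
    have hu : 0 ≤ u ⬝ᵥ (P1 *ᵥ u) := by
      by_cases h0 : u = 0
      · simp [h0]
      · exact (hp u h0).le
    have hw1 := mul_nonneg h1.le (aux_dot_self_nonneg w1)
    have hw2 := mul_nonneg h2.le (aux_dot_self_nonneg w2)
    by_contra hc
    apply hy
    have hu0 : u = 0 := by
      by_contra h0
      have := hp u h0
      linarith
    have e1 : m1 * (w1 ⬝ᵥ w1) = 0 := by linarith
    have e2 : m2 * (w2 ⬝ᵥ w2) = 0 := by linarith
    have hw10 : w1 = 0 := by simpa [h1.ne'] using e1
    have hw20 : w2 = 0 := by simpa [h2.ne'] using e2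
    subst hu0 hw10 hw20
    simp

set_option maxHeartbeats 2000000 in
/-- Feasibility of the LMI constraints of Theorem 2 (Dirichlet
boundary measurement): there exist `N ≥ N₀+1`, a symmetric positive definite `P`,
and reals `α > 1`, `β, γ > 0` such that `Θ₁ ⪯ 0` and `Θ₂ ≤ 0`, where `Θ₂` is built
from `M₁ = ∑_{n≥2} x_n²/λ_n`. -/
theorem lmi_feasibility_dirichlet_measurement
    (N₀ : ℕ) (hN₀ : 1 ≤ N₀) (δ qc pstar : ℝ) (hδ : 0 < δ) (hpstar : 0 < pstar)
    (lam a b x : ℕ → ℝ)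
    (hmono : ∀ n, 1 ≤ n → lam n ≤ lam (n + 1))
    (hnonneg : ∀ n, 1 ≤ n → 0 ≤ lam n)
    (hlow : ∀ n : ℕ, 1 ≤ n → Real.pi ^ 2 * ((n : ℝ) - 1) ^ 2 * pstar ≤ lam n)
    (hgap : ∀ n, N₀ + 1 ≤ n → -lam n + qc < -δ)
    (ha : Summable fun n : ℕ => a (n + 1) ^ 2)
    (hb : Summable fun n : ℕ => b (n + 1) ^ 2)
    (hM1 : Summable fun n : ℕ => x (n + 2) ^ 2 / lam (n + 2))
    (K : Matrix (Fin 1) (Fin 1 ⊕ Fin N₀) ℝ) (L : Matrix (Fin N₀) (Fin 1) ℝ)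
    (hK : specLt (A1 N₀ lam qc a + B1 N₀ b * K) (-δ))
    (hL : specLt (A0 N₀ lam qc - L * C0 N₀ x) (-δ)) :
    ∃ N : ℕ, N₀ + 1 ≤ N ∧
      ∃ P : Matrix (ιF N₀ N) (ιF N₀ N) ℝ, P.IsSymm ∧ P.PosDef ∧
        ∃ α β γ : ℝ, 1 < α ∧ 0 < β ∧ 0 < γ ∧
          (Matrix.fromBlocks
            ((Fmat N₀ N lam a b qc K L (C0 N₀ x) (C1 N₀ N lam x))ᵀ * P +
              P * Fmat N₀ N lam a b qc K L (C0 N₀ x) (C1 N₀ N lam x) + (2 * δ) • P +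
              (α * γ) • Gmat N₀ N (∑' n : ℕ, a (n + 1) ^ 2) (∑' n : ℕ, b (n + 1) ^ 2) K)
            (P * Lcal N₀ N L) ((Lcal N₀ N L)ᵀ * P)
            ((-β) • (1 : Matrix (Fin 1) (Fin 1) ℝ))).NegSemidef ∧
          2 * γ * (-(1 - 1 / α) * lam (N + 1) + qc + δ)
            + β * (∑' n : ℕ, x (n + 2) ^ 2 / lam (n + 2)) ≤ 0 := by
  -- constants
  set na2 := ∑' n : ℕ, a (n + 1) ^ 2 with hna2
  set nb2 := ∑' n : ℕ, b (n + 1) ^ 2 with hnb2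
  set M1 := ∑' n : ℕ, x (n + 2) ^ 2 / lam (n + 2) with hM1d
  have hna0 : 0 ≤ na2 := tsum_nonneg fun n => sq_nonneg _
  have hnb0 : 0 ≤ nb2 := tsum_nonneg fun n => sq_nonneg _
  have hMn : ∀ n : ℕ, 0 ≤ x (n + 2) ^ 2 / lam (n + 2) := fun n =>
    div_nonneg (sq_nonneg _) (hnonneg _ (by omega))
  have hM0 : 0 ≤ M1 := tsum_nonneg hMn
  set S := Matrix.fromBlocks (A1 N₀ lam qc a + B1 N₀ b * K) (Ltil N₀ L * C0 N₀ x)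
        0 (A0 N₀ lam qc - L * C0 N₀ x) with hS
  obtain ⟨P1, hP1s, hP1p, hP1l⟩ := aux_lyapunov S δ (aux_specLt_blocks _ _ _ _ hK hL)
  set l : (Fin 1 ⊕ Fin N₀) ⊕ Fin N₀ → ℝ :=
    Sum.elim (fun i => Ltil N₀ L i 0) (fun i => - L i 0) with hl
  set g2 := (P1 *ᵥ l) ⬝ᵥ (P1 *ᵥ l) with hg2
  have hg20 : 0 ≤ g2 := aux_dot_self_nonneg _
  set k2 := (K 0) ⬝ᵥ (K 0) with hk2
  have hk20 : 0 ≤ k2 := aux_dot_self_nonneg _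
  set κ := lam (N₀ + 1) - qc - δ with hκd
  have hκ : 0 < κ := by
    have := hgap (N₀ + 1) le_rfl
    rw [hκd]; linarith
  have hlamκ : ∀ n, N₀ + 1 ≤ n → -lam n + qc ≤ -δ - κ := by
    intro n hn
    have : lam (N₀ + 1) ≤ lam n := by
      induction n, hn using Nat.le_induction with
      | base => exact le_rfl
      | succ m hm ih => exact ih.trans (hmono m (by omega))
    rw [hκd]; linarith
  set g0 := na2 + nb2 * k2 with hg0
  have hg00 : 0 ≤ g0 := by positivity
  set m1 := κ / (8 * (g0 + 1)) with hm1
  set m2 := (2 * g2 * M1 + 1) / κ with hm2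
  set γ := 1 / (8 * (g0 + 1)) with hγ
  set β := 4 * g2 + 1 with hβ
  have hm1p : 0 < m1 := by positivity
  have hm2p : 0 < m2 := by positivity
  have hγp : 0 < γ := by positivity
  have hβp : 0 < β := by positivity
  -- choice of N
  obtain ⟨N, hN, hNbig⟩ : ∃ N : ℕ, N₀ + 1 ≤ N ∧ 2 * (qc + δ) + β * M1 / γ ≤ lam (N + 1) := by
    have hpp : 0 < Real.pi ^ 2 * pstar := by positivity
    obtain ⟨n, hn⟩ := exists_nat_ge ((2 * (qc + δ) + β * M1 / γ) / (Real.pi ^ 2 * pstar))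
    refine ⟨n + N₀ + 1, by omega, ?_⟩
    have h1 := hlow (n + N₀ + 1 + 1) (by omega)
    push_cast at h1
    rw [div_le_iff₀ hpp] at hn
    refine le_trans hn (le_trans ?_ h1)
    have h2 : (n : ℝ) ≤ ((n : ℝ) + N₀ + 1 + 1 - 1) ^ 2 := by
      have e1 : (0 : ℝ) ≤ n := Nat.cast_nonneg n
      have e2 : (0 : ℝ) ≤ N₀ := Nat.cast_nonneg N₀
      nlinarith
    nlinarith
  refine ⟨N, hN, auxP N₀ N P1 m1 m2, auxP_symm _ _ _ _ _ hP1s,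
    auxP_posDef _ _ _ _ _ hP1s hP1p hm1p hm2p, 2, β, γ, by norm_num, hβp, hγp, ?_, ?_⟩
  swap
  · have h1 : β * M1 = γ * (β * M1 / γ) := by field_simp
    rw [h1]
    nlinarith
  apply aux_negsemidef _ _ _ _ _ _ _ (auxP_symm _ _ _ _ _ hP1s) (aux_G_symm _ _ _ _ _)
  intro y z
  obtain ⟨u1, u2, w1, w2, rfl⟩ : ∃ u1 u2 w1 w2,
      y = Sum.elim (Sum.elim u1 u2) (Sum.elim w1 w2) :=
    ⟨(y ∘ Sum.inl) ∘ Sum.inl, (y ∘ Sum.inl) ∘ Sum.inr, (y ∘ Sum.inr) ∘ Sum.inl,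
      (y ∘ Sum.inr) ∘ Sum.inr, by simp only [Sum.elim_comp_inl_inr]⟩
  have hLc : (fun i => Lcal N₀ N L i 0) = Sum.elim l (Sum.elim 0 0) := by
    ext i
    rcases i with (i | i) | (i | i) <;> simp [Lcal, hl]
  rw [aux_Fmat_mulVec, aux_G_quad, auxP_mulVec, hLc, ← hS, ← hl]
  set u := Sum.elim u1 u2 with hu
  simp only [sumElim_dotProduct_sumElim, dotProduct_smul, smul_eq_mul, add_dotProduct,
    smul_dotProduct, zero_dotProduct, mul_zero, add_zero]
  set v : Fin (N - N₀) → ℝ :=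
    fun i => b (N₀ + 1 + i.1) * (K *ᵥ u1) 0 + a (N₀ + 1 + i.1) * u1 (Sum.inl 0) with hv
  set c2 := (C1 N₀ N lam x *ᵥ w2) 0 with hc2
  set s := l ⬝ᵥ (P1 *ᵥ u) with hs
  set e := u1 (Sum.inl 0) with he
  set k := (K *ᵥ u1) 0 with hk
  have hU0 := aux_dot_self_nonneg u
  have hW1 := aux_dot_self_nonneg w1
  have hW2 := aux_dot_self_nonneg w2
  have hU1 : u1 ⬝ᵥ u1 ≤ u ⬝ᵥ u := by
    rw [hu, sumElim_dotProduct_sumElim]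
    linarith [aux_dot_self_nonneg u2]
  have he2 : e ^ 2 ≤ u ⬝ᵥ u := by
    refine le_trans ?_ hU1
    rw [sq, dotProduct]
    exact Finset.single_le_sum (f := fun i => u1 i * u1 i) (fun i _ => mul_self_nonneg _)
      (Finset.mem_univ (Sum.inl 0))
  have hk2' : k ^ 2 ≤ k2 * (u ⬝ᵥ u) :=
    (aux_cs (K 0) u1).trans (mul_le_mul_of_nonneg_left hU1 hk20)
  have hs2 : s ^ 2 ≤ (u ⬝ᵥ u) * g2 := by
    have : s = u ⬝ᵥ (P1 *ᵥ l) := by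
      rw [hs, Matrix.dotProduct_mulVec, ← Matrix.mulVec_transpose, hP1s.eq, dotProduct_comm]
    rw [this]
    exact aux_cs _ _
  have hC1 : (C1 N₀ N lam x 0) ⬝ᵥ (C1 N₀ N lam x 0) ≤ M1 := by
    have := aux_sum_le _ hM1 hMn (N - N₀) (N₀ - 1)
    refine le_trans (le_of_eq ?_) this
    rw [dotProduct]
    refine Finset.sum_congr rfl fun i _ => ?_
    have e1 : N₀ - 1 + i.1 + 2 = N₀ + 1 + i.1 := by omega
    rw [e1]
    simp only [C1, Matrix.of_apply]
    rw [← sq, div_pow, Real.sq_sqrt (hnonneg _ (by omega))]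
  have hc22 : c2 ^ 2 ≤ M1 * (w2 ⬝ᵥ w2) :=
    (aux_cs _ w2).trans (mul_le_mul_of_nonneg_right hC1 hW2)
  have hsum : ∀ f : ℕ → ℝ, Summable (fun n : ℕ => f (n + 1) ^ 2) →
      ∑ i : Fin (N - N₀), f (N₀ + 1 + i.1) ^ 2 ≤ ∑' n : ℕ, f (n + 1) ^ 2 := by
    intro f hf
    have := aux_sum_le _ hf (fun n => sq_nonneg _) (N - N₀) N₀
    refine le_trans (le_of_eq ?_) this
    refine Finset.sum_congr rfl fun i _ => ?_
    rw [show N₀ + i.1 + 1 = N₀ + 1 + i.1 by omega]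
  have hvv : v ⬝ᵥ v ≤ 2 * g0 * (u ⬝ᵥ u) := by
    have h1 : v ⬝ᵥ v ≤ ∑ i : Fin (N - N₀),
        (2 * k ^ 2 * b (N₀ + 1 + i.1) ^ 2 + 2 * e ^ 2 * a (N₀ + 1 + i.1) ^ 2) := by
      rw [dotProduct]
      refine Finset.sum_le_sum fun i _ => ?_
      simp only [hv]
      nlinarith [sq_nonneg (b (N₀ + 1 + i.1) * k - a (N₀ + 1 + i.1) * e)]
    rw [Finset.sum_add_distrib, ← Finset.mul_sum, ← Finset.mul_sum] at h1
    have h2 : 2 * k ^ 2 * ∑ i : Fin (N - N₀), b (N₀ + 1 + i.1) ^ 2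
        ≤ 2 * (k2 * (u ⬝ᵥ u)) * nb2 := by
      have := hsum b hb
      gcongr
    have h3 : 2 * e ^ 2 * ∑ i : Fin (N - N₀), a (N₀ + 1 + i.1) ^ 2
        ≤ 2 * (u ⬝ᵥ u) * na2 := by
      have := hsum a ha
      gcongr
    rw [hg0]
    linarith
  have hvw : 2 * (v ⬝ᵥ w1) ≤ κ * (w1 ⬝ᵥ w1) + κ⁻¹ * (2 * g0 * (u ⬝ᵥ u)) := by
    apply aux_young _ _ _ _ hκ (by positivity) hW1
    refine (aux_cs v w1).trans ?_
    rw [mul_comm]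
    gcongr
  have hcs : 2 * (c2 * s) ≤ 4⁻¹ * (u ⬝ᵥ u) + (4⁻¹)⁻¹ * (g2 * (M1 * (w2 ⬝ᵥ w2))) := by
    apply aux_young _ _ _ _ (by norm_num) (by positivity) hU0
    rw [mul_pow, ← mul_assoc, mul_comm]
    gcongr
  have hzs : 2 * (z * s) ≤ 4⁻¹ * (u ⬝ᵥ u) + (4⁻¹)⁻¹ * (g2 * z ^ 2) := by
    apply aux_young _ _ _ _ (by norm_num) (by positivity) hU0
    rw [mul_pow, ← mul_assoc, mul_comm]
    gcongr
  have hA1 := aux_A2_le N₀ N lam qc κ δ hlamκ w1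
  have hA2 := aux_A2_le N₀ N lam qc κ δ hlamκ w2
  have hly := hP1l u
  have hG : 2 * γ * (na2 * e ^ 2 + nb2 * k ^ 2) ≤ 4⁻¹ * (u ⬝ᵥ u) := by
    have h1 : na2 * e ^ 2 + nb2 * k ^ 2 ≤ g0 * (u ⬝ᵥ u) := by
      have e1 := mul_le_mul_of_nonneg_left he2 hna0
      have e2 := mul_le_mul_of_nonneg_left hk2' hnb0
      rw [hg0]
      linarith
    have h2 : 2 * γ * g0 ≤ 4⁻¹ := by
      rw [hγ]
      field_simp
      linarith
    calc 2 * γ * (na2 * e ^ 2 + nb2 * k ^ 2) ≤ 2 * γ * (g0 * (u ⬝ᵥ u)) := by gcongr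
      _ = (2 * γ * g0) * (u ⬝ᵥ u) := by ring
      _ ≤ _ := by gcongr
  have hT2 : m1 * (2 * (v ⬝ᵥ w1) + 2 * ((A2 N₀ N lam qc *ᵥ w1) ⬝ᵥ w1) + 2 * δ * (w1 ⬝ᵥ w1))
      ≤ 4⁻¹ * (u ⬝ᵥ u) := by
    have h1 : 2 * (v ⬝ᵥ w1) + 2 * ((A2 N₀ N lam qc *ᵥ w1) ⬝ᵥ w1) + 2 * δ * (w1 ⬝ᵥ w1)
        ≤ κ⁻¹ * (2 * g0 * (u ⬝ᵥ u)) := by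
      nlinarith [mul_nonneg hκ.le hW1]
    have h2 : m1 * (κ⁻¹ * (2 * g0)) ≤ 4⁻¹ := by
      rw [hm1]
      field_simp
      linarith
    calc _ ≤ m1 * (κ⁻¹ * (2 * g0 * (u ⬝ᵥ u))) := mul_le_mul_of_nonneg_left h1 hm1p.le
      _ = (m1 * (κ⁻¹ * (2 * g0))) * (u ⬝ᵥ u) := by ring
      _ ≤ _ := by gcongr
  have hT3 : m2 * (2 * ((A2 N₀ N lam qc *ᵥ w2) ⬝ᵥ w2) + 2 * δ * (w2 ⬝ᵥ w2))
      ≤ -((4 * g2 * M1 + 2) * (w2 ⬝ᵥ w2)) := by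
    have h1 : 2 * ((A2 N₀ N lam qc *ᵥ w2) ⬝ᵥ w2) + 2 * δ * (w2 ⬝ᵥ w2)
        ≤ - (2 * κ * (w2 ⬝ᵥ w2)) := by linarith
    calc _ ≤ m2 * (- (2 * κ * (w2 ⬝ᵥ w2))) := mul_le_mul_of_nonneg_left h1 hm2p.le
      _ = _ := by
        rw [hm2]
        field_simp
        ring
  have hβz : β * z ^ 2 = 4 * (g2 * z ^ 2) + z ^ 2 := by rw [hβ]; ring
  rw [hβz]
  norm_num at hcs hzs hG hT2
  have hz2 := sq_nonneg z
  linarith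

end
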